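/- Let L be a subfield of ℂ and V a linear subspace of ℂ^n. Then V has a basis consisting of vectors all of whose coordinates lie in L if and only if V is invariant under the coordinatewise action of every field automorphism of ℂ fixing L pointwise. -/

import Mathlib

open MvPolynomial IntermediateField.algebraAdjoinAdjoin in
theorem AlgebraicIndependent.exists_aeval_eq_of_mem_adjoin {F E ι : Type*} [Field F] [Field E]
    [Algebra F E] {v : ι → E} (hv : AlgebraicIndependent F v) {x : E}
    (hx : IsIntegral (Algebra.adjoin F (Set.range v)) x)
    (hmem : x ∈ IntermediateField.adjoin F (Set.range v)) : ∃ p : MvPolynomial ι F, aeval v p = x := by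
  have : IsIntegrallyClosed (Algebra.adjoin F (Set.range v)) :=
    .of_equiv hv.aevalEquiv.toRingEquiv
  have hint : IsIntegral (Algebra.adjoin F (Set.range v))
      (⟨x, hmem⟩ : IntermediateField.adjoin F (Set.range v)) :=
    (isIntegral_algebraMap_iff
      (algebraMap (IntermediateField.adjoin F (Set.range v)) E).injective).mp hx
  obtain ⟨y, hy⟩ := IsIntegrallyClosed.isIntegral_iff.mp hint
  refine ⟨hv.aevalEquiv.symm y, ?_⟩
  rw [← hv.algebraMap_aevalEquiv, AlgEquiv.apply_symm_apply]
  exact congrArg Subtype.val hy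

open MvPolynomial in
theorem IsTranscendenceBasis.exists_algEquiv_apply_ne {F E ι : Type*} [Field F] [Field E]
    [Algebra F E] [CharZero F] [IsAlgClosed E] {v : ι → E} (hv : IsTranscendenceBasis F v) {x : E}
    (hx : IsIntegral (Algebra.adjoin F (Set.range v)) x) (hne : ∀ p : MvPolynomial ι F, aeval v p ≠ x) :
    ∃ σ : E ≃ₐ[F] E, σ x ≠ x := by
  have halg := hv.isAlgebraic_field
  have : CharZero (IntermediateField.adjoin F (Set.range v)) := charZero_of_injective_algebraMap
    (algebraMap F _).injective
  have : IsAlgClosure (IntermediateField.adjoin F (Set.range v)) E := ⟨inferInstance, halg⟩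
  have : Normal (IntermediateField.adjoin F (Set.range v)) E := IsAlgClosure.normal _ _
  have : IsGalois (IntermediateField.adjoin F (Set.range v)) E := ⟨⟩
  by_contra! h
  obtain ⟨y, hy⟩ := (InfiniteGalois.mem_range_algebraMap_iff_fixed x).mpr
    fun f : E ≃ₐ[IntermediateField.adjoin F (Set.range v)] E ↦ h (f.restrictScalars F)
  obtain ⟨p, hp⟩ := hv.1.exists_aeval_eq_of_mem_adjoin hx (hy ▸ y.2)
  exact hne p hp

theorem MvPolynomial.exists_eq_C_of_isAlgebraic {F ι : Type*} [Field F] {p : MvPolynomial ι F}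
    (hp : IsAlgebraic F p) : ∃ c, p = C c := by
  by_cases h0 : p = 0
  · exact ⟨0, by simp [h0]⟩
  obtain ⟨c, -, hc⟩ := MvPolynomial.isUnit_iff_eq_C_of_isReduced.mp
    (hp.isIntegral.isUnit h0)
  exact ⟨c, hc⟩

open MvPolynomial in
theorem IsAlgClosed.mem_range_algebraMap_of_forall_algEquiv {F E : Type*} [Field F] [Field E]
    [Algebra F E] [CharZero F] [IsAlgClosed E] {x : E} (h : ∀ σ : E ≃ₐ[F] E, σ x = x) :
    x ∈ Set.range (algebraMap F E) := by
  by_contra hx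
  by_cases halg : IsAlgebraic F x
  · obtain ⟨s, hs⟩ := exists_isTranscendenceBasis F E
    obtain ⟨σ, hσ⟩ := hs.exists_algEquiv_apply_ne halg.isIntegral.tower_top fun p hp ↦ by
      obtain ⟨c, rfl⟩ := exists_eq_C_of_isAlgebraic
        ((isAlgebraic_algHom_iff (aeval ((↑) : s → E)) hs.1).mp (by rwa [hp]))
      exact hx ⟨c, by simpa using hp⟩
    exact hσ (h σ)
  · have hsq : AlgebraicIndepOn F id {x ^ 2} :=
      (algebraicIndependent_singleton_iff (⟨x ^ 2, rfl⟩ : ({x ^ 2} : Set E))).mpr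
        fun h2 ↦ halg (IsAlgebraic.of_pow two_pos h2)
    obtain ⟨s, hxs, hs⟩ := exists_isTranscendenceBasis_superset hsq
    have hmem : x ^ 2 ∈ s := hxs rfl
    obtain ⟨σ, hσ⟩ := hs.exists_algEquiv_apply_ne (x := x)
      (.of_pow two_pos (isIntegral_algebraMap (R := Algebra.adjoin F (Set.range ((↑) : s → E)))
        (x := ⟨x ^ 2, Algebra.subset_adjoin ⟨⟨_, hmem⟩, rfl⟩⟩))) fun p hp ↦ by
      have hX : X (⟨x ^ 2, hmem⟩ : s) = p * p := hs.1 (by simp [hp, sq])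
      exact (MvPolynomial.X_prime).irreducible.not_isSquare ⟨p, hX⟩
    exact hσ (h σ)

/-- Galois descent for subspaces of `ι → K`. -/
theorem Submodule.le_span_of_forall_ringEquiv_mem {K ι : Type*} [Field K] [Fintype ι]
    {L : Subfield K}
    (hL : ∀ x : K, (∀ σ : K ≃+* K, (∀ y ∈ L, σ y = y) → σ x = x) → x ∈ L)
    {V : Submodule K (ι → K)}
    (hV : ∀ σ : K ≃+* K, (∀ x ∈ L, σ x = x) → ∀ v ∈ V, (fun i ↦ σ (v i)) ∈ V) :
    V ≤ span K {v | v ∈ V ∧ ∀ i, v i ∈ L} := by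
  classical
  let supp (v : ι → K) : Finset ι := {i | v i ≠ 0}
  suffices H : ∀ (t : Finset ι), ∀ u ∈ V, supp u = t → u ∈ span K {v | v ∈ V ∧ ∀ i, v i ∈ L} from
    fun u hu ↦ H _ u hu rfl
  intro t
  induction t using Finset.strongInduction with
  | H t ih =>
    rintro u hu rfl
    by_cases hu0 : u = 0
    · exact hu0 ▸ zero_mem _
    obtain ⟨v, ⟨hvV, hv0, hvu⟩, hmin⟩ := WellFounded.has_min
      (InvImage.wf supp (Finset.isWellFounded_ssubset (α := ι)).wf)
      {v | v ∈ V ∧ v ≠ 0 ∧ supp v ⊆ supp u} ⟨u, hu, hu0, subset_rfl⟩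
    obtain ⟨i, hi⟩ := Function.ne_iff.mp hv0
    have hi : v i ≠ 0 := hi
    set w := (v i)⁻¹ • v with hw
    have hwV : w ∈ V := V.smul_mem _ hvV
    have hwi : w i = 1 := by simp [hw, hi]
    have hws : ∀ j, v j = 0 → w j = 0 := fun j hj ↦ by simp [hw, hj]
    have hwL : ∀ j, w j ∈ L := fun j ↦ hL _ fun σ hσ ↦ by
      by_contra hne
      refine hmin ((fun k ↦ σ (w k)) - w) ⟨V.sub_mem (hV σ hσ w hwV) hwV,
        fun h0 ↦ hne (sub_eq_zero.mp (congrFun h0 j)), ?_⟩ ?_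
      · refine fun k hk ↦ hvu ?_
        simp only [supp, Finset.mem_filter, Finset.mem_univ, true_and] at hk ⊢
        exact fun h ↦ hk (by simp [hws k h])
      · refine (Finset.ssubset_iff_of_subset fun k hk ↦ ?_).mpr ⟨i, by simp [supp, hi], ?_⟩
        · simp only [supp, Finset.mem_filter, Finset.mem_univ, true_and] at hk ⊢
          exact fun h ↦ hk (by simp [hws k h])
        · simp [supp, hwi]
    have hwspan : w ∈ span K {v | v ∈ V ∧ ∀ i, v i ∈ L} := subset_span ⟨hwV, hwL⟩
    have hui : i ∈ supp u := hvu (by simp [supp, hi])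
    have hsub : supp (u - u i • w) ⊂ supp u := by
      refine (Finset.ssubset_iff_of_subset fun k hk ↦ ?_).mpr ⟨i, hui, by simp [supp, hwi]⟩
      by_contra hku
      have hkv : v k = 0 := by
        by_contra h
        exact hku (hvu (by simp [supp, h]))
      have hku : u k = 0 := by simpa [supp] using hku
      simp [supp, hku, hws k hkv] at hk
    have := ih _ hsub _ (V.sub_mem hu (V.smul_mem _ hwV)) rfl
    simpa using add_mem this (smul_mem _ (u i) hwspan)

theorem Complex.mem_of_forall_ringEquiv {L : Subfield ℂ} {x : ℂ}
    (h : ∀ σ : ℂ ≃+* ℂ, (∀ y ∈ L, σ y = y) → σ x = x) : x ∈ L := by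
  obtain ⟨y, rfl⟩ := IsAlgClosed.mem_range_algebraMap_of_forall_algEquiv (F := L) (x := x)
    fun σ ↦ h σ.toRingEquiv fun y hy ↦ σ.commutes ⟨y, hy⟩
  exact y.2

/-- A subspace `V ⊆ ℂ^n` has a basis consisting of vectors with all
coordinates in a subfield `L` of `ℂ` iff `V` is invariant under the coordinatewise action
of every field automorphism of `ℂ` fixing `L` pointwise. -/
theorem stmt_0 (n : ℕ) (L : Subfield ℂ) (V : Submodule ℂ (Fin n → ℂ)) :
    (∃ s : Finset (Fin n → ℂ),
      (↑s : Set (Fin n → ℂ)) ⊆ (V : Set (Fin n → ℂ)) ∧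
      (∀ v ∈ s, ∀ i, v i ∈ L) ∧
      Submodule.span ℂ (↑s : Set (Fin n → ℂ)) = V ∧
      LinearIndependent ℂ (fun v : {x // x ∈ s} => (v : Fin n → ℂ))) ↔
    (∀ σ : ℂ ≃+* ℂ, (∀ x ∈ L, σ x = x) →
      ∀ v ∈ V, (fun i => σ (v i)) ∈ V) := by
  constructor
  · rintro ⟨s, hsV, hsL, rfl, -⟩ σ hσ v hv
    induction hv using Submodule.span_induction with
    | mem v hv =>
      have : (fun i => σ (v i)) = v := funext fun i ↦ hσ _ (hsL v hv i)
      rw [this]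
      exact Submodule.subset_span hv
    | zero =>
      simp only [Pi.zero_apply, map_zero]
      exact Submodule.zero_mem _
    | add v w _ _ hv hw => simpa using! add_mem hv hw
    | smul c v _ hv => simpa using! Submodule.smul_mem _ (σ c) hv
  · intro hV
    obtain ⟨b, hbsub, hbspan, hbli⟩ :=
      exists_linearIndependent ℂ {v : Fin n → ℂ | v ∈ V ∧ ∀ i, v i ∈ L}
    have hfin : b.Finite := hbli.setFinite
    refine ⟨hfin.toFinset, fun v hv ↦ (hbsub (hfin.mem_toFinset.mp hv)).1,
      fun v hv ↦ (hbsub (hfin.mem_toFinset.mp hv)).2, ?_, ?_⟩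
    · rw [hfin.coe_toFinset, hbspan]
      exact le_antisymm (Submodule.span_le.mpr fun v hv ↦ hv.1)
        (Submodule.le_span_of_forall_ringEquiv_mem (fun x ↦ Complex.mem_of_forall_ringEquiv) hV)
    · exact hbli.comp (fun v : {x // x ∈ hfin.toFinset} ↦ (⟨v, hfin.mem_toFinset.mp v.2⟩ : b))
        fun v w h ↦ Subtype.ext (congrArg (fun z : b ↦ (z : Fin n → ℂ)) h)
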